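/- Suppose F_ξ^{−1,↑} is not constant, and set σ_F↑ = (∫₀¹ (F_ξ^{−1,↑}(u) − μ_F)² du)^{1/2}. If ε < (μ_F−μ)² + (σ_F−σ)² + 2σ_F σ(1−ĉ₀), then F_{U,ξ}(μ,σ,ε) is empty. If ε = (μ_F−μ)² + (σ_F−σ)² + 2σ_F σ(1−ĉ₀), then F_{U,ξ}(μ,σ,ε) consists of exactly one distribution, namely the one whose quantile function is μ + σ (F_ξ^{−1,↑} − μ_F)/σ_F↑. -/

import Mathlib

open MeasureTheory Set Filter

noncomputable section

/-- Left quantile function of a distribution function `G`. -/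
def leftQ (G : ℝ → ℝ) (p : ℝ) : ℝ := sInf {x : ℝ | p ≤ G x}

/-- `G` is a cumulative distribution function. -/
def IsCDF (G : ℝ → ℝ) : Prop :=
  Monotone G ∧ (∀ x : ℝ, ContinuousWithinAt G (Ici x) x) ∧
    Tendsto G atBot (nhds 0) ∧ Tendsto G atTop (nhds 1)

/-- `G ∈ M²`: a cdf with finite second moment. -/
def MemM2 (G : ℝ → ℝ) : Prop :=
  IsCDF G ∧ IntegrableOn (fun t => (leftQ G t) ^ 2) (Ioo (0:ℝ) 1)

/-- Mean of `f(V)` for `V` uniform on `(0,1)`. -/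
def mean01 (f : ℝ → ℝ) : ℝ := ∫ t in Ioo (0:ℝ) 1, f t

/-- Variance of `f(V)` for `V` uniform on `(0,1)`. -/
def var01 (f : ℝ → ℝ) : ℝ := ∫ t in Ioo (0:ℝ) 1, (f t - mean01 f) ^ 2

/-- Covariance of `f(V)` and `h(V)` for `V` uniform on `(0,1)`. -/
def cov01 (f h : ℝ → ℝ) : ℝ := ∫ t in Ioo (0:ℝ) 1, (f t - mean01 f) * (h t - mean01 h)

/-- Pearson correlation of `f(V)` and `h(V)` for `V` uniform on `(0,1)`. -/
def corr01 (f h : ℝ → ℝ) : ℝ := cov01 f h / (Real.sqrt (var01 f) * Real.sqrt (var01 h))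

/-- Standard deviation of `f(V)` for `V` uniform on `(0,1)`. -/
def sd01 (f : ℝ → ℝ) : ℝ := Real.sqrt (var01 f)

/-- `L²(0,1)` norm. -/
def l2norm (f : ℝ → ℝ) : ℝ := Real.sqrt (∫ u in Ioo (0:ℝ) 1, (f u) ^ 2)

/-- Distortion risk metric expressed via the quantile function:
`ρ_g(h) = ∫₀¹ γ(u) h(u) du` where `γ` is the weight function of `g`. -/
def rhoQ (γ h : ℝ → ℝ) : ℝ := ∫ u in Ioo (0:ℝ) 1, γ u * h u

/-- `h` belongs to `F⁻¹_{U,ξ}`: it is a quantile function of a unimodal distribution with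
inflection point `ξ`, i.e. nondecreasing and continuous on `(0,1)`, concave on `(0,ξ)`,
convex on `(ξ,1)`, and square integrable on `(0,1)`. -/
def UQuant (ξ : ℝ) (h : ℝ → ℝ) : Prop :=
  MonotoneOn h (Ioo (0:ℝ) 1) ∧ ContinuousOn h (Ioo (0:ℝ) 1) ∧
    ConcaveOn ℝ (Ioo (0:ℝ) ξ) h ∧ ConvexOn ℝ (Ioo ξ 1) h ∧
    IntegrableOn (fun t => (h t) ^ 2) (Ioo (0:ℝ) 1)

/-- `γp` is the `L²(0,1)`-projection of `γ` onto `F⁻¹_{U,ξ}`. -/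
def IsProj (ξ : ℝ) (γ γp : ℝ → ℝ) : Prop :=
  UQuant ξ γp ∧ ∀ h : ℝ → ℝ, UQuant ξ h →
    (∫ u in Ioo (0:ℝ) 1, (γ u - γp u) ^ 2) ≤ ∫ u in Ioo (0:ℝ) 1, (γ u - h u) ^ 2

/-- `G ∈ F_{U,ξ}`: `G` is a unimodal cdf in `M²` with inflection point `ξ`. -/
def UnimodalCDF (ξ : ℝ) (G : ℝ → ℝ) : Prop :=
  MemM2 G ∧ ContinuousOn (leftQ G) (Ioo (0:ℝ) 1) ∧
    ConcaveOn ℝ (Ioo (0:ℝ) ξ) (leftQ G) ∧ ConvexOn ℝ (Ioo ξ 1) (leftQ G)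

/-- `F_{U,ξ}(μ,σ)`. -/
def FUset (ξ μ σ : ℝ) : Set (ℝ → ℝ) :=
  {G | UnimodalCDF ξ G ∧ mean01 (leftQ G) = μ ∧
    mean01 (fun t => (leftQ G t) ^ 2) = μ ^ 2 + σ ^ 2}

/-- `F_{U,ξ}(μ,σ,ε)`: additionally within 2-Wasserstein distance `√ε` of `F`. -/
def FUEset (ξ : ℝ) (F : ℝ → ℝ) (μ σ ε : ℝ) : Set (ℝ → ℝ) :=
  {G | G ∈ FUset ξ μ σ ∧
    Real.sqrt (∫ t in Ioo (0:ℝ) 1, (leftQ F t - leftQ G t) ^ 2) ≤ Real.sqrt ε}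

/-- `F_{U,[ξ₁,ξ₂]}(μ,σ)`: unimodal with some inflection point in `[ξ₁,ξ₂]`. -/
def FUIset (ξ₁ ξ₂ μ σ : ℝ) : Set (ℝ → ℝ) :=
  {G | (∃ ξ ∈ Icc ξ₁ ξ₂, UnimodalCDF ξ G) ∧ mean01 (leftQ G) = μ ∧
    mean01 (fun t => (leftQ G t) ^ 2) = μ ^ 2 + σ ^ 2}

/-- `f` is constant on `(0,1)`. -/
def ConstOn01 (f : ℝ → ℝ) : Prop := ∃ c : ℝ, ∀ t ∈ Ioo (0:ℝ) 1, f t = c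


local notation "unif" => (volume.restrict (Ioo (0:ℝ) 1) : Measure ℝ)

instance isProbabilityMeasure_unif : IsProbabilityMeasure unif :=
  ⟨by simp⟩

lemma memLp_two_of_monotoneOn {f : ℝ → ℝ} (hm : MonotoneOn f (Ioo (0:ℝ) 1))
    (hi : IntegrableOn (fun t => (f t) ^ 2) (Ioo (0:ℝ) 1)) : MemLp f 2 unif :=
  (memLp_two_iff_integrable_sq
    (aemeasurable_restrict_of_monotoneOn measurableSet_Ioo hm).aestronglyMeasurable).2 hi

lemma UQuant.memLp {ξ : ℝ} {h : ℝ → ℝ} (hh : UQuant ξ h) : MemLp h 2 unif :=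
  memLp_two_of_monotoneOn hh.1 hh.2.2.2.2

lemma uQuant_const (ξ c : ℝ) : UQuant ξ (fun _ => c) :=
  ⟨monotoneOn_const, continuousOn_const, concaveOn_const c (convex_Ioo _ _),
    convexOn_const c (convex_Ioo _ _), by
      simp⟩

lemma UQuant.const_mul {ξ c : ℝ} {h : ℝ → ℝ} (hh : UQuant ξ h) (hc : 0 ≤ c) :
    UQuant ξ (fun t => c * h t) := by
  refine ⟨fun x hx y hy hxy => mul_le_mul_of_nonneg_left (hh.1 hx hy hxy) hc,
    continuousOn_const.mul hh.2.1, hh.2.2.1.smul hc, hh.2.2.2.1.smul hc, ?_⟩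
  simp only [mul_pow]
  exact hh.2.2.2.2.const_mul (c ^ 2)

lemma UQuant.add {ξ : ℝ} {h k : ℝ → ℝ} (hh : UQuant ξ h) (hk : UQuant ξ k) :
    UQuant ξ (fun t => h t + k t) :=
  ⟨hh.1.add hk.1, hh.2.1.add hk.2.1, hh.2.2.1.add hk.2.2.1, hh.2.2.2.1.add hk.2.2.2.1,
    (hh.memLp.add hk.memLp).integrable_sq⟩

lemma integral_add_smul_sq {f h : ℝ → ℝ} (hf : MemLp f 2 unif) (hh : MemLp h 2 unif) (c : ℝ) :
    (∫ t in Ioo (0:ℝ) 1, (f t + c * h t) ^ 2) = (∫ t in Ioo (0:ℝ) 1, (f t) ^ 2)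
      + 2 * c * (∫ t in Ioo (0:ℝ) 1, f t * h t) + c ^ 2 * ∫ t in Ioo (0:ℝ) 1, (h t) ^ 2 := by
  have h1 : Integrable (fun t => f t ^ 2) unif := hf.integrable_sq
  have h2 : Integrable (fun t => 2 * c * (f t * h t)) unif := (hf.integrable_mul hh).const_mul _
  have h3 : Integrable (fun t => c ^ 2 * h t ^ 2) unif := hh.integrable_sq.const_mul _
  have h12 : Integrable (fun t => f t ^ 2 + 2 * c * (f t * h t)) unif := h1.add h2
  rw [← integral_const_mul, ← integral_const_mul, ← integral_add h1 h2, ← integral_add h12 h3]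
  congr 1
  ext t
  ring

lemma integral_sub_const_mul_sub_const {f h : ℝ → ℝ} (hf : MemLp f 2 unif) (hh : MemLp h 2 unif)
    (a b : ℝ) :
    (∫ t in Ioo (0:ℝ) 1, (f t - a) * (h t - b)) = (∫ t in Ioo (0:ℝ) 1, f t * h t)
      - a * mean01 h - b * mean01 f + a * b := by
  have h1 : Integrable (fun t => f t * h t) unif := hf.integrable_mul hh
  have h2 : Integrable (fun t => a * h t) unif := (hh.integrable one_le_two).const_mul _
  have h3 : Integrable (fun t => b * f t) unif := (hf.integrable one_le_two).const_mul _
  have h12 : Integrable (fun t => f t * h t - a * h t) unif := h1.sub h2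
  have h123 : Integrable (fun t => f t * h t - a * h t - b * f t) unif := h12.sub h3
  have h4 : (∫ t in Ioo (0:ℝ) 1, a * b) = a * b := by simp
  have hexp : ∀ t, (f t - a) * (h t - b) = f t * h t - a * h t - b * f t + a * b := by
    intro t; ring
  simp only [hexp]
  rw [integral_add h123 (integrable_const _), integral_sub h12 h3, integral_sub h1 h2,
    integral_const_mul, integral_const_mul, h4, mean01, mean01]

lemma cov01_eq {f h : ℝ → ℝ} (hf : MemLp f 2 unif) (hh : MemLp h 2 unif) :
    cov01 f h = (∫ t in Ioo (0:ℝ) 1, f t * h t) - mean01 f * mean01 h := by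
  rw [cov01, integral_sub_const_mul_sub_const hf hh]
  ring

lemma var01_eq {f : ℝ → ℝ} (hf : MemLp f 2 unif) :
    var01 f = (∫ t in Ioo (0:ℝ) 1, f t ^ 2) - mean01 f ^ 2 := by
  have := cov01_eq hf hf
  simpa only [cov01, var01, sq] using this

lemma var01_nonneg (f : ℝ → ℝ) : 0 ≤ var01 f := integral_nonneg fun _ => sq_nonneg _

lemma nonpos_of_forall_quadratic_nonneg {A B : ℝ}
    (h : ∀ c : ℝ, 0 ≤ c → c ≤ 1 → 0 ≤ 2 * c * (-A) + c ^ 2 * B) : A ≤ 0 := by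
  by_contra! hA
  have hB : 0 < |B| + A := by positivity
  have hc : 0 < A / (|B| + A) := by positivity
  have := h (A / (|B| + A)) hc.le ((div_le_one hB).2 (by linarith [abs_nonneg B]))
  have h1 : A / (|B| + A) * B ≤ A := by
    rw [div_mul_eq_mul_div, div_le_iff₀ hB]
    nlinarith [le_abs_self B]
  nlinarith

/-- First-order optimality of the projection along a feasible direction. -/
lemma IsProj.integral_mul_nonpos {ξ : ℝ} {f p h : ℝ → ℝ} (hp : IsProj ξ f p)
    (hf : MemLp f 2 unif) (hh : MemLp h 2 unif)
    (hd : ∀ c : ℝ, 0 ≤ c → c ≤ 1 → UQuant ξ (fun t => p t + c * h t)) :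
    (∫ t in Ioo (0:ℝ) 1, f t * h t) ≤ ∫ t in Ioo (0:ℝ) 1, p t * h t := by
  have hp2 := hp.1.memLp
  have key : (∫ t in Ioo (0:ℝ) 1, (f t - p t) * h t) ≤ 0 := by
    apply nonpos_of_forall_quadratic_nonneg (B := ∫ t in Ioo (0:ℝ) 1, (h t) ^ 2)
    intro c h0 h1
    have hmin := hp.2 _ (hd c h0 h1)
    have hexp := integral_add_smul_sq (hf.sub hp2) hh (-c)
    simp only [Pi.sub_apply] at hexp
    have heq : (∫ t in Ioo (0:ℝ) 1, (f t - (p t + c * h t)) ^ 2)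
        = ∫ t in Ioo (0:ℝ) 1, (f t - p t + -c * h t) ^ 2 := by
      congr 1
      ext t
      ring
    rw [heq, hexp] at hmin
    linarith
  have hsub : (∫ t in Ioo (0:ℝ) 1, (f t - p t) * h t)
      = (∫ t in Ioo (0:ℝ) 1, f t * h t) - ∫ t in Ioo (0:ℝ) 1, p t * h t := by
    have h1 : Integrable (fun t => f t * h t) unif := hf.integrable_mul hh
    have h2 : Integrable (fun t => p t * h t) unif := hp2.integrable_mul hh
    simp only [sub_mul]
    exact integral_sub h1 h2
  linarith

lemma IsProj.integral_mul_le {ξ : ℝ} {f p h : ℝ → ℝ} (hp : IsProj ξ f p)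
    (hf : MemLp f 2 unif) (hh : UQuant ξ h) :
    (∫ t in Ioo (0:ℝ) 1, f t * h t) ≤ ∫ t in Ioo (0:ℝ) 1, p t * h t :=
  hp.integral_mul_nonpos hf hh.memLp fun _ h0 _ => hp.1.add (hh.const_mul h0)

lemma IsProj.integral_mul_self {ξ : ℝ} {f p : ℝ → ℝ} (hp : IsProj ξ f p)
    (hf : MemLp f 2 unif) :
    (∫ t in Ioo (0:ℝ) 1, f t * p t) = ∫ t in Ioo (0:ℝ) 1, p t ^ 2 := by
  have h1 := hp.integral_mul_le hf hp.1
  have h2 := hp.integral_mul_nonpos hf (h := fun t => -p t) hp.1.memLp.neg fun c _ h1 => by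
    convert hp.1.const_mul (sub_nonneg.2 h1) using 2
    ring
  simp only [mul_neg, integral_neg] at h2
  simp only [sq]
  linarith

lemma IsProj.mean01_eq {ξ : ℝ} {f p : ℝ → ℝ} (hp : IsProj ξ f p) (hf : MemLp f 2 unif) :
    mean01 p = mean01 f := by
  have h1 := hp.integral_mul_le hf (uQuant_const ξ 1)
  have h2 := hp.integral_mul_le hf (uQuant_const ξ (-1))
  simp only [mul_one, mul_neg, integral_neg] at h1 h2
  unfold mean01
  linarith

lemma eqOn_of_integral_sub_sq_nonpos {f h : ℝ → ℝ} (hf : MemLp f 2 unif) (hh : MemLp h 2 unif)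
    (hfc : ContinuousOn f (Ioo (0:ℝ) 1)) (hhc : ContinuousOn h (Ioo (0:ℝ) 1))
    (h0 : (∫ t in Ioo (0:ℝ) 1, (f t - h t) ^ 2) ≤ 0) : EqOn f h (Ioo (0:ℝ) 1) := by
  have hi : Integrable (fun t => (f t - h t) ^ 2) unif := (hf.sub hh).integrable_sq
  have hz := (integral_eq_zero_iff_of_nonneg (fun t => sq_nonneg (f t - h t)) hi).1
    (le_antisymm h0 (integral_nonneg fun t => sq_nonneg _))
  refine Measure.eqOn_Ioo_of_ae_eq volume ?_ hfc hhc
  filter_upwards [hz] with t ht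
  exact sub_eq_zero.1 (pow_eq_zero_iff two_ne_zero |>.1 ht)

lemma leftQ_monotoneOn {G : ℝ → ℝ} (hG : IsCDF G) : MonotoneOn (leftQ G) (Ioo (0:ℝ) 1) := by
  intro s hs t ht hst
  obtain ⟨hm, -, hbot, htop⟩ := hG
  refine csInf_le_csInf ?_ ?_ fun x hx => hst.trans hx
  · obtain ⟨y, hy⟩ := (hbot.eventually_lt_const hs.1).exists
    exact ⟨y, fun x hx => le_of_not_gt fun hxy => absurd (hm hxy.le) (not_le.2 (hy.trans_le hx))⟩
  · obtain ⟨y, hy⟩ := (htop.eventually_const_lt ht.2).exists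
    exact ⟨y, hy.le⟩

lemma UnimodalCDF.uQuant {ξ : ℝ} {G : ℝ → ℝ} (hG : UnimodalCDF ξ G) : UQuant ξ (leftQ G) :=
  ⟨leftQ_monotoneOn hG.1.1, hG.2.1, hG.2.2.1, hG.2.2.2, hG.1.2⟩

/-- Every nondecreasing continuous function on `(0,1)` is a left quantile function there. -/
lemma exists_isCDF_leftQ_eqOn {q : ℝ → ℝ} (hm : MonotoneOn q (Ioo (0:ℝ) 1))
    (hc : ContinuousOn q (Ioo (0:ℝ) 1)) :
    ∃ G : ℝ → ℝ, IsCDF G ∧ EqOn (leftQ G) q (Ioo (0:ℝ) 1) := by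
  have hq : AEMeasurable q unif := aemeasurable_restrict_of_monotoneOn measurableSet_Ioo hm
  have : IsProbabilityMeasure (Measure.map q unif) := Measure.isProbabilityMeasure_map hq
  refine ⟨ProbabilityTheory.cdf (Measure.map q unif), ⟨ProbabilityTheory.monotone_cdf _,
    (ProbabilityTheory.cdf _).right_continuous, ProbabilityTheory.tendsto_cdf_atBot _,
    ProbabilityTheory.tendsto_cdf_atTop _⟩, fun t ht => ?_⟩
  have hcdf (x : ℝ) : ProbabilityTheory.cdf (Measure.map q unif) x
      = (unif).real (q ⁻¹' Iic x) := by
    rw [ProbabilityTheory.cdf_eq_real, measureReal_def, measureReal_def,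
      Measure.map_apply_of_aemeasurable hq measurableSet_Iic]
  have hset : {x : ℝ | t ≤ ProbabilityTheory.cdf (Measure.map q unif) x} = Ici (q t) := by
    ext x
    rw [mem_ofPred_eq, hcdf, mem_Ici]
    constructor
    · intro hx
      by_contra! hlt
      have hev : ∀ᶠ s in nhds t, x < q s ∧ s ∈ Ioo (0:ℝ) 1 :=
        ((hc.continuousAt (Ioo_mem_nhds ht.1 ht.2)).eventually_const_lt hlt).and
          (Ioo_mem_nhds ht.1 ht.2)
      obtain ⟨s, ⟨hxs, hs⟩, hst⟩ :=
        ((hev.filter_mono nhdsWithin_le_nhds).and (self_mem_nhdsWithin (s := Iio t))).exists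
      have hle : (unif).real (q ⁻¹' Iic x) ≤ s := by
        rw [measureReal_restrict_apply' measurableSet_Ioo]
        calc volume.real (q ⁻¹' Iic x ∩ Ioo 0 1) ≤ volume.real (Ioo 0 s) := by
              refine measureReal_mono (fun u hu => ⟨hu.2.1, ?_⟩) (by simp)
              by_contra! hsu
              exact absurd (hm hs hu.2 hsu) (not_le.2 (lt_of_le_of_lt hu.1 hxs))
          _ = s := by simp [hs.1.le]
      exact absurd (hx.trans hle) (not_le.2 hst)
    · intro hx
      rw [measureReal_restrict_apply' measurableSet_Ioo]
      calc t = volume.real (Ioc 0 t) := by simp [ht.1.le]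
        _ ≤ volume.real (q ⁻¹' Iic x ∩ Ioo 0 1) := by
          refine measureReal_mono (fun u hu => ?_)
            (measure_ne_top_of_subset inter_subset_right (by simp))
          have hu1 : u ∈ Ioo (0:ℝ) 1 := ⟨hu.1, hu.2.trans_lt ht.2⟩
          exact ⟨(hm hu1 ht hu.2).trans hx, hu1⟩
  rw [leftQ, hset, csInf_Ici]

lemma UQuant.exists_unimodalCDF {ξ : ℝ} (hξ : ξ ∈ Icc (0:ℝ) 1) {q : ℝ → ℝ} (hq : UQuant ξ q) :
    ∃ G : ℝ → ℝ, UnimodalCDF ξ G ∧ EqOn (leftQ G) q (Ioo (0:ℝ) 1) := by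
  obtain ⟨G, hG, heq⟩ := exists_isCDF_leftQ_eqOn hq.1 hq.2.1
  refine ⟨G, ⟨⟨hG, hq.2.2.2.2.congr_fun (fun t ht => ?_) measurableSet_Ioo⟩,
    hq.2.1.congr heq, hq.2.2.1.congr fun t ht => ?_, hq.2.2.2.1.congr fun t ht => ?_⟩, heq⟩
  · simp only [heq ht]
  · exact (heq ⟨ht.1, ht.2.trans_le hξ.2⟩).symm
  · exact (heq ⟨hξ.1.trans_lt ht.1, ht.2⟩).symm

lemma UQuant.var01_pos {ξ : ℝ} {p : ℝ → ℝ} (hp : UQuant ξ p) (hnc : ¬ ConstOn01 p) :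
    0 < var01 p := by
  by_contra! h
  exact hnc ⟨mean01 p, eqOn_of_integral_sub_sq_nonpos hp.memLp (memLp_const _) hp.2.1
    continuousOn_const h⟩

lemma integral_sub_sq {f h : ℝ → ℝ} (hf : MemLp f 2 unif) (hh : MemLp h 2 unif) :
    (∫ t in Ioo (0:ℝ) 1, (f t - h t) ^ 2) = (∫ t in Ioo (0:ℝ) 1, (f t) ^ 2)
      - 2 * (∫ t in Ioo (0:ℝ) 1, f t * h t) + ∫ t in Ioo (0:ℝ) 1, (h t) ^ 2 := by
  have := integral_add_smul_sq hf hh (-1)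
  simp only [neg_one_mul, ← sub_eq_add_neg] at this
  rw [this]
  ring

lemma mean01_standardize {p : ℝ → ℝ} (hp : MemLp p 2 unif) (μ c : ℝ) :
    mean01 (fun t => μ + c * (p t - mean01 p)) = μ := by
  have hi : Integrable p unif := hp.integrable one_le_two
  have h1 : Integrable (fun t => p t - mean01 p) unif := hi.sub (integrable_const _)
  have h2 : (∫ t in Ioo (0:ℝ) 1, (p t - mean01 p)) = 0 := by
    rw [integral_sub hi (integrable_const _)]
    simp [mean01]
  rw [mean01, integral_add (integrable_const _) (h1.const_mul c), integral_const_mul, h2]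
  simp

lemma integral_mul_standardize {f p : ℝ → ℝ} (hf : MemLp f 2 unif) (hp : MemLp p 2 unif)
    (μ c : ℝ) :
    (∫ t in Ioo (0:ℝ) 1, f t * (μ + c * (p t - mean01 p))) = μ * mean01 f + c * cov01 f p := by
  have h1 : Integrable (fun t => f t * p t) unif := hf.integrable_mul hp
  have hi : Integrable f unif := hf.integrable one_le_two
  have hmf : (∫ t in Ioo (0:ℝ) 1, f t) = mean01 f := rfl
  have hexp : ∀ t, f t * (μ + c * (p t - mean01 p)) = (μ - c * mean01 p) * f t + c * (f t * p t) := by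
    intro t; ring
  simp only [hexp]
  rw [integral_add (hi.const_mul _) (h1.const_mul c), integral_const_mul, integral_const_mul, hmf,
    cov01_eq hf hp]
  ring

lemma integral_standardize_sq {p : ℝ → ℝ} (hp : MemLp p 2 unif) (μ c : ℝ) :
    (∫ t in Ioo (0:ℝ) 1, (μ + c * (p t - mean01 p)) ^ 2) = μ ^ 2 + c ^ 2 * var01 p := by
  have hs : MemLp (fun t => μ + c * (p t - mean01 p)) 2 unif :=
    (memLp_const μ).add ((hp.sub (memLp_const _)).const_mul c)
  have h1 := integral_mul_standardize hs hp μ c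
  have h2 : cov01 (fun t => μ + c * (p t - mean01 p)) p = c * var01 p := by
    rw [cov01, mean01_standardize hp, var01, ← integral_const_mul]
    congr 1
    ext t
    ring
  rw [mean01_standardize hp, h2] at h1
  simp only [sq] at h1 ⊢
  linarith

theorem stmt_14 (ξ : ℝ) (hξ : ξ ∈ Icc (0:ℝ) 1) (F : ℝ → ℝ) (μ σ ε : ℝ)
    (hF : MemM2 F) (hσF : 0 < sd01 (leftQ F)) (hσ : 0 < σ) (hε : 0 < ε)
    (Fp : ℝ → ℝ) (hFp : IsProj ξ (leftQ F) Fp) (hnc : ¬ ConstOn01 Fp) :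
    (ε < (mean01 (leftQ F) - μ) ^ 2 + (sd01 (leftQ F) - σ) ^ 2
        + 2 * sd01 (leftQ F) * σ * (1 - corr01 (leftQ F) Fp) →
      FUEset ξ F μ σ ε = ∅) ∧
    (ε = (mean01 (leftQ F) - μ) ^ 2 + (sd01 (leftQ F) - σ) ^ 2
        + 2 * sd01 (leftQ F) * σ * (1 - corr01 (leftQ F) Fp) →
      (FUEset ξ F μ σ ε).Nonempty ∧
      ∀ G ∈ FUEset ξ F μ σ ε, ∀ t ∈ Ioo (0:ℝ) 1,
        leftQ G t = μ + σ * (Fp t - mean01 (leftQ F)) /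
          Real.sqrt (∫ u in Ioo (0:ℝ) 1, (Fp u - mean01 (leftQ F)) ^ 2)) := by
  have hf : MemLp (leftQ F) 2 unif := memLp_two_of_monotoneOn (leftQ_monotoneOn hF.1) hF.2
  have hp := hFp.1.memLp
  have hmean := hFp.mean01_eq hf
  have hvp := hFp.1.var01_pos hnc
  have hsp : 0 < sd01 Fp := Real.sqrt_pos.2 hvp
  have hsp2 : sd01 Fp ^ 2 = var01 Fp := Real.sq_sqrt hvp.le
  have hsf2 : sd01 (leftQ F) ^ 2 = var01 (leftQ F) := Real.sq_sqrt (var01_nonneg _)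
  have hcov : cov01 (leftQ F) Fp = var01 Fp := by
    rw [cov01_eq hf hp, var01_eq hp, hFp.integral_mul_self hf, hmean]
    ring
  have hcorr : sd01 (leftQ F) * corr01 (leftQ F) Fp = sd01 Fp := by
    change _ * (_ / (sd01 (leftQ F) * sd01 Fp)) = _
    rw [hcov, ← hsp2]
    field_simp
  have hbound : (mean01 (leftQ F) - μ) ^ 2 + (sd01 (leftQ F) - σ) ^ 2
        + 2 * sd01 (leftQ F) * σ * (1 - corr01 (leftQ F) Fp)
      = (∫ t in Ioo (0:ℝ) 1, (leftQ F t) ^ 2) + μ ^ 2 + σ ^ 2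
        - 2 * (μ * mean01 (leftQ F) + σ * sd01 Fp) := by
    linear_combination hsf2 + var01_eq hf - 2 * σ * hcorr
  rw [hbound]
  -- the candidate optimizer
  set c := σ / sd01 Fp with hc
  have hc0 : 0 < c := div_pos hσ hsp
  have hcs : c * sd01 Fp = σ := div_mul_cancel₀ _ hsp.ne'
  have hcv : c * var01 Fp = σ * sd01 Fp := by rw [← hsp2, ← hcs]; ring
  have hq : UQuant ξ (fun t => μ + c * (Fp t - mean01 Fp)) := by
    convert (uQuant_const ξ (μ - c * mean01 Fp)).add (hFp.1.const_mul hc0.le) using 2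
    ring
  have hqsq : (∫ t in Ioo (0:ℝ) 1, (μ + c * (Fp t - mean01 Fp)) ^ 2) = μ ^ 2 + σ ^ 2 := by
    rw [integral_standardize_sq hp, ← hcs, ← hsp2]
    ring
  have hG : ∀ G ∈ FUEset ξ F μ σ ε,
      (∫ t in Ioo (0:ℝ) 1, (leftQ F t) ^ 2) + μ ^ 2 + σ ^ 2
        - 2 * (∫ t in Ioo (0:ℝ) 1, Fp t * leftQ G t) ≤ ε := by
    rintro G ⟨⟨hU, -, hG2⟩, hd⟩
    rw [Real.sqrt_le_sqrt_iff hε.le, integral_sub_sq hf hU.uQuant.memLp] at hd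
    rw [mean01] at hG2
    linarith [hFp.integral_mul_le hf hU.uQuant]
  have hdist : ∀ G ∈ FUEset ξ F μ σ ε,
      (∫ t in Ioo (0:ℝ) 1, (leftQ G t - (μ + c * (Fp t - mean01 Fp))) ^ 2)
        = 2 * c * (μ * mean01 (leftQ F) + σ * sd01 Fp
          - ∫ t in Ioo (0:ℝ) 1, Fp t * leftQ G t) := by
    rintro G ⟨⟨hU, hG1, hG2⟩, -⟩
    have hg := hU.uQuant.memLp
    rw [integral_sub_sq hg hq.memLp, hqsq, integral_mul_standardize hg hp, cov01_eq hg hp, hG1,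
      hmean]
    rw [mean01] at hG2
    simp only [mul_comm (leftQ G _)]
    rw [hG2]
    linear_combination (-2 * σ) * hcs
  refine ⟨fun hlt => eq_empty_of_forall_notMem fun G hGm => ?_, fun heq => ⟨?_, fun G hGm => ?_⟩⟩
  · have h1 := hG G hGm
    have h2 := hdist G hGm
    have h3 : 0 ≤ ∫ t in Ioo (0:ℝ) 1, (leftQ G t - (μ + c * (Fp t - mean01 Fp))) ^ 2 :=
      integral_nonneg fun _ => sq_nonneg _
    rw [h2] at h3
    linarith [nonneg_of_mul_nonneg_right h3 (by positivity)]
  · obtain ⟨G, hU, hGq⟩ := hq.exists_unimodalCDF hξ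
    refine ⟨G, ⟨hU, ?_, ?_⟩, Real.sqrt_le_sqrt ?_⟩
    · rw [mean01, setIntegral_congr_fun measurableSet_Ioo hGq]
      exact mean01_standardize hp μ c
    · rw [mean01, ← hqsq]
      exact setIntegral_congr_fun measurableSet_Ioo fun t ht => by simp only [hGq ht]
    · rw [setIntegral_congr_fun (g := fun t => (leftQ F t - (μ + c * (Fp t - mean01 Fp))) ^ 2)
        measurableSet_Ioo fun t ht => by simp only [hGq ht],
        integral_sub_sq hf hq.memLp, hqsq, integral_mul_standardize hf hp, hcov, hcv, heq]
      linarith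
  · have h1 := hG G hGm
    have h2 := hdist G hGm
    have hU := hGm.1.1
    have hEq := eqOn_of_integral_sub_sq_nonpos hU.uQuant.memLp hq.memLp hU.2.1 hq.2.1 (by
      rw [h2]
      exact mul_nonpos_of_nonneg_of_nonpos (by positivity) (by linarith))
    intro t ht
    rw [hEq ht, ← hmean, hc]
    change _ = μ + σ * (Fp t - mean01 Fp) / sd01 Fp
    ring

end
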